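/- arXiv:1511.05415 — 4 statements merged into one kernel-verified Lean document; each statement's English description precedes it below -/
import Mathlib

section
/- Let d be an odd positive integer and let S be a set of permutations of ZMod d such that every π ∈ S is an involution (π ∘ π = id) and for every ordered pair (a,b) ∈ ZMod d × ZMod d there is exactly one π ∈ S with π(a) = b. Then every π ∈ S has exactly one fixed point. -/
/-- Let `d` be an odd positive integer and `S` a set of permutations of
`ZMod d` such that every `π ∈ S` is an involution (P1) and for every ordered pair
`(a,b)` there is exactly one `π ∈ S` with `π(a) = b` (P2). Then every `π ∈ S` has
exactly one fixed point. -/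
theorem stmt_1 (d : ℕ) (hodd : Odd d) (hpos : 0 < d)
    (S : Set (Equiv.Perm (ZMod d)))
    (hP1 : ∀ π ∈ S, ∀ x : ZMod d, π (π x) = x)
    (hP2 : ∀ a b : ZMod d, ∃! π : Equiv.Perm (ZMod d), π ∈ S ∧ π a = b) :
    ∀ π ∈ S, ∃! x : ZMod d, π x = x := by
  have : NeZero d := ⟨hpos.ne'⟩
  have exists_fixed : ∀ π ∈ S, ∃ x : ZMod d, π x = x := by
    intro π hπ
    refine Equiv.Perm.exists_fixed_point_of_prime (p := 2) (n := 1) ?_ ?_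
    · rw [ZMod.card]
      exact hodd.not_two_dvd_nat
    · ext1 x
      simp [pow_two, hP1 π hπ x]
  choose f hf using fun x : ZMod d => (hP2 x x).exists
  have f_eq : ∀ π ∈ S, ∀ x, π x = x → f x = π := fun π hπ x hx =>
    (hP2 x x).unique (hf x) ⟨hπ, hx⟩
  have surj : Function.Surjective fun x => f x 0 := by
    intro b
    obtain ⟨π, hπ, hb⟩ := (hP2 0 b).exists
    obtain ⟨x, hx⟩ := exists_fixed π hπ
    exact ⟨x, by simp only [f_eq π hπ x hx, hb]⟩
  have inj := Finite.injective_iff_surjective.mpr surj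
  intro π hπ
  obtain ⟨x, hx⟩ := exists_fixed π hπ
  refine ⟨x, hx, fun y hy => inj ?_⟩
  simp only [f_eq π hπ x hx, f_eq π hπ y hy]
end

section
/- Let G be a finite simple graph with an edge-labeling K : E(G) → ZMod 2 (a signed graph, where label 1 denotes a negative edge). Then every cycle of G contains an even number of negative edges if and only if the vertex set of G can be partitioned into two disjoint subsets such that each 0-labeled edge joins two vertices in the same subset and each 1-labeled edge joins two vertices from different subsets. -/
namespace SimpleGraph.Walk

variable {V : Type*} {G : SimpleGraph V} {K : Sym2 V → ZMod 2}

/-- If all cycles are balanced, closing a path by an edge between its endpoints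
gives label sum zero, even when the path consists of that edge only. -/
lemma IsPath.label_add_sum_edges_eq_zero
    (hK : ∀ (u : V) (w : G.Walk u u), w.IsCycle → (w.edges.map K).sum = 0)
    {u v : V} {p : G.Walk v u} (hp : p.IsPath) (h : G.Adj u v) :
    K s(u, v) + (p.edges.map K).sum = 0 := by
  by_cases he : s(u, v) ∈ p.edges
  · cases p with
    | nil => simp at he
    | @cons _ x _ h' q =>
      rw [cons_isPath_iff] at hp
      rw [edges_cons, List.mem_cons] at he
      rcases he with he | he
      · obtain rfl : u = x := by
          rw [Sym2.eq_swap, Sym2.congr_right] at he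
          exact he
        obtain rfl := (isPath_iff_nil.mp hp.1).eq_nil
        simp [Sym2.eq_swap (a := u), CharTwo.add_self_eq_zero]
      · exact absurd (q.snd_mem_support_of_mem_edges he) hp.2
  · simpa using hK u (cons h p) ((cons_isCycle_iff p h).mpr ⟨hp, he⟩)

/-- If all cycles are balanced, bypassing a walk preserves its label sum. -/
lemma sum_edges_bypass [DecidableEq V]
    (hK : ∀ (u : V) (w : G.Walk u u), w.IsCycle → (w.edges.map K).sum = 0)
    {u v : V} (p : G.Walk u v) : (p.bypass.edges.map K).sum = (p.edges.map K).sum := by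
  induction p with
  | nil => rfl
  | @cons u v w h p ih =>
    rw [edges_cons, List.map_cons, List.sum_cons, ← ih, bypass]
    split_ifs with hs
    · have hsum := congrArg (fun q : G.Walk v w => (q.edges.map K).sum) (p.bypass.take_spec hs)
      simp only [edges_append, List.map_append, List.sum_append] at hsum
      rw [← hsum, ← add_assoc,
        IsPath.label_add_sum_edges_eq_zero hK (p.bypass_isPath.takeUntil hs) h, zero_add]
    · simp

/-- If all cycles are balanced, then all closed walks are. -/
lemma sum_edges_eq_zero_of_forall_isCycle
    (hK : ∀ (u : V) (w : G.Walk u u), w.IsCycle → (w.edges.map K).sum = 0)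
    {u : V} (p : G.Walk u u) : (p.edges.map K).sum = 0 := by
  classical
  rw [← sum_edges_bypass hK p, (isPath_iff_nil.mp p.bypass_isPath).eq_nil]
  simp

/-- If the edge labels are the coboundary of `f`, the label sum of a walk depends only on
its endpoints. -/
lemma sum_edges_eq_add_of_forall_adj {f : V → ZMod 2}
    (hf : ∀ u v, G.Adj u v → K s(u, v) = f u + f v) {u v : V} (p : G.Walk u v) :
    (p.edges.map K).sum = f u + f v := by
  induction p with
  | nil => simp [CharTwo.add_self_eq_zero]
  | @cons u v w h p ih =>
    rw [edges_cons, List.map_cons, List.sum_cons, ih, hf _ _ h]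
    linear_combination CharTwo.add_self_eq_zero (f v)

end SimpleGraph.Walk

/-- If all cycles are balanced, the edge labels are the coboundary of a vertex labeling. -/
lemma SimpleGraph.exists_label_eq_add_of_forall_isCycle {V : Type*} {G : SimpleGraph V}
    {K : Sym2 V → ZMod 2}
    (hK : ∀ (u : V) (w : G.Walk u u), w.IsCycle → (w.edges.map K).sum = 0) :
    ∃ f : V → ZMod 2, ∀ u v, G.Adj u v → K s(u, v) = f u + f v := by
  have p (v : V) : G.Walk (G.connectedComponentMk v).out v :=
    (ConnectedComponent.exact (Quot.out_eq _) : G.Reachable _ v).some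
  refine ⟨fun v => ((p v).edges.map K).sum, fun u v h => ?_⟩
  have hroot : (G.connectedComponentMk v).out = (G.connectedComponentMk u).out := by
    rw [ConnectedComponent.sound h.reachable]
  have hsum := Walk.sum_edges_eq_zero_of_forall_isCycle hK
    ((p u).append (Walk.cons h ((p v).reverse.copy rfl hroot)))
  simp only [Walk.edges_append, Walk.edges_cons, Walk.edges_copy, Walk.edges_reverse,
    List.map_append, List.map_cons, List.map_reverse, List.sum_append, List.sum_cons,
    List.sum_reverse] at hsum
  rw [← CharTwo.add_eq_zero, ← hsum]
  ring

/-- A signed graph (finite simple graph with edge labels in `ZMod 2`,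
label `1` = negative edge) has every cycle containing an even number of negative
edges if and only if its vertex set can be partitioned into two disjoint subsets
(`A` and its complement) so that each `0`-labeled edge joins two vertices in the same
subset and each `1`-labeled edge joins two vertices from different subsets. -/
theorem stmt_5 {V : Type*} [Fintype V] (G : SimpleGraph V) (K : Sym2 V → ZMod 2) :
    (∀ (u : V) (w : G.Walk u u), w.IsCycle → (w.edges.map K).sum = 0) ↔
    (∃ A : Set V, ∀ u v : V, G.Adj u v →
      (K s(u, v) = 0 → ((u ∈ A) ↔ (v ∈ A))) ∧
      (K s(u, v) = 1 → ((u ∈ A) ↔ (v ∉ A)))) := by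
  classical
  constructor
  · intro hK
    obtain ⟨f, hf⟩ := G.exists_label_eq_add_of_forall_isCycle hK
    refine ⟨{v | f v = 0}, fun u v h => ?_⟩
    rw [hf u v h, Set.mem_ofPred_eq, Set.mem_ofPred_eq]
    generalize f u = a
    generalize f v = b
    decide +revert
  · rintro ⟨A, hA⟩ u w -
    rw [w.sum_edges_eq_add_of_forall_adj (f := fun v => if v ∈ A then 0 else 1),
      CharTwo.add_self_eq_zero]
    intro u v h
    obtain ⟨h0, h1⟩ := hA u v h
    generalize K s(u, v) = k at h0 h1 ⊢
    by_cases hu : u ∈ A <;> by_cases hv : v ∈ A <;> simp only [hu, hv, if_true, if_false] at * <;>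
      decide +revert
end

section
/- Let G be a finite simple graph with an edge-labeling K : E(G) → ZMod 2. The contradiction number β_C(G,K), defined as the minimum over all f : V(G) → ZMod 2 of the number of edges {u,v} with f(u) + f(v) ≠ K({u,v}), equals the minimum cardinality of a set F ⊆ E(G) of edges whose removal leaves a graph in which every cycle contains an even number of 1-labeled edges. -/
/-- The sum of the values of `f` at the two endpoints of an unordered pair. -/
def edgeSum2 {V : Type*} (f : V → ZMod 2) : Sym2 V → ZMod 2 :=
  Sym2.lift ⟨fun u v => f u + f v, fun u v => add_comm (f u) (f v)⟩

namespace SimpleGraph.Walk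

variable {V : Type*} {H : SimpleGraph V} {K : Sym2 V → ZMod 2}

/-- A path from `v` to `u` that uses the edge `uv` consists of that edge alone. -/
theorem IsPath.edges_eq_singleton {u v : V} {p : H.Walk v u} (hp : p.IsPath)
    (he : s(u, v) ∈ p.edges) : p.edges = [s(u, v)] := by
  cases p with
  | nil => simp at he
  | @cons _ x _ h q =>
    rw [cons_isPath_iff] at hp
    rw [edges_cons, List.mem_cons] at he
    rcases he with he | he
    · have hx : x = u := by
        rcases Sym2.eq_iff.1 he with ⟨h₁, h₂⟩ | ⟨h₁, -⟩
        · exact h₂ ▸ h₁.symm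
        · exact h₁.symm
      subst hx
      rw [eq_nil_iff_nil.2 (isPath_iff_nil.1 hp.1)]
      simp [Sym2.eq_swap]
    · exact absurd (q.snd_mem_support_of_mem_edges he) hp.2

/-- If all cycles have label sum zero, bypassing a walk preserves its label sum. -/
theorem sum_map_edges_bypass [DecidableEq V]
    (hc : ∀ (u : V) (w : H.Walk u u), w.IsCycle → (w.edges.map K).sum = 0)
    {u v : V} (w : H.Walk u v) : (w.bypass.edges.map K).sum = (w.edges.map K).sum := by
  induction w with
  | nil => rfl
  | @cons u x v h p ih =>
    rw [bypass]
    split_ifs with hs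
    · have hpath : (p.bypass.takeUntil u hs).IsPath := p.bypass_isPath.takeUntil hs
      have hsplit := congrArg (fun q => (q.edges.map K).sum) (p.bypass.take_spec hs)
      simp only [edges_append, List.map_append, List.sum_append, ih] at hsplit
      have hzero : K s(u, x) + ((p.bypass.takeUntil u hs).edges.map K).sum = 0 := by
        by_cases he : s(u, x) ∈ (p.bypass.takeUntil u hs).edges
        · simp [hpath.edges_eq_singleton he, CharTwo.add_self_eq_zero]
        · simpa using hc u _ (Path.cons_isCycle ⟨_, hpath⟩ h he)
      rw [edges_cons, List.map_cons, List.sum_cons, ← hsplit, ← add_assoc, hzero, zero_add]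
    · simp [ih]

/-- If all cycles have label sum zero, so have all closed walks. -/
theorem sum_map_edges_closed
    (hc : ∀ (u : V) (w : H.Walk u u), w.IsCycle → (w.edges.map K).sum = 0)
    {u : V} (w : H.Walk u u) : (w.edges.map K).sum = 0 := by
  classical
  rw [← sum_map_edges_bypass hc w, eq_nil_iff_nil.2 (isPath_iff_nil.1 w.bypass_isPath)]
  simp

/-- If all cycles have label sum zero, the label sum of a walk depends only on its ends. -/
theorem sum_map_edges_eq
    (hc : ∀ (u : V) (w : H.Walk u u), w.IsCycle → (w.edges.map K).sum = 0)
    {u v : V} (p q : H.Walk u v) : (p.edges.map K).sum = (q.edges.map K).sum := by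
  have h := sum_map_edges_closed hc (p.append q.reverse)
  simpa [List.sum_reverse, CharTwo.add_eq_zero] using h

theorem sum_map_edgeSum2 (f : V → ZMod 2) {u v : V} (w : H.Walk u v) :
    (w.edges.map (edgeSum2 f)).sum = f u + f v := by
  induction w with
  | nil => simp [CharTwo.add_self_eq_zero]
  | @cons u x v h p ih =>
    rw [edges_cons, List.map_cons, List.sum_cons, ih]
    change f u + f x + (f x + f v) = f u + f v
    rw [add_assoc, CharTwo.add_cancel_left]

end SimpleGraph.Walk

/-- If all cycles have label sum zero, some assignment satisfies every edge. -/
theorem SimpleGraph.exists_edgeSum2_eq {V : Type*} {H : SimpleGraph V} {K : Sym2 V → ZMod 2}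
    (hc : ∀ (u : V) (w : H.Walk u u), w.IsCycle → (w.edges.map K).sum = 0) :
    ∃ f : V → ZMod 2, ∀ e ∈ H.edgeSet, edgeSum2 f e = K e := by
  have hr : ∀ v, H.Reachable (H.connectedComponentMk v).out v := fun v =>
    ConnectedComponent.exact (Quot.out_eq _)
  let f : V → ZMod 2 := fun v => ((hr v).some.edges.map K).sum
  have hf : ∀ {r v : V} (q : H.Walk r v), r = (H.connectedComponentMk v).out →
      (q.edges.map K).sum = f v := by
    rintro r v q rfl
    exact Walk.sum_map_edges_eq hc _ _
  refine ⟨f, fun e => ?_⟩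
  induction e with
  | h u v =>
    intro h
    have hadj : H.Adj u v := h
    have hcomp : (H.connectedComponentMk u).out = (H.connectedComponentMk v).out :=
      congrArg Quot.out (ConnectedComponent.sound hadj.reachable)
    have hv := hf ((hr u).some.concat hadj) hcomp
    rw [Walk.edges_concat, List.concat_eq_append, List.map_append, List.sum_append] at hv
    change f u + f v = K s(u, v)
    rw [← hv]
    simp only [List.map_cons, List.map_nil, List.sum_cons, List.sum_nil, add_zero]
    exact CharTwo.add_cancel_left _ _

/-- For a finite simple graph `G` with edge-labeling `K : E(G) → ZMod 2`,
the contradiction number `β_C(G,K)` (the minimum over all assignments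
`f : V(G) → ZMod 2` of the number of edges `{u,v}` with `f(u) + f(v) ≠ K({u,v})`)
equals the minimum cardinality of a set `F` of edges whose removal leaves a graph in
which every cycle contains an even number of `1`-labeled edges. -/
theorem stmt_6 {V : Type*} [Fintype V] (G : SimpleGraph V) (K : Sym2 V → ZMod 2) :
    sInf { n : ℕ | ∃ f : V → ZMod 2,
        {e : Sym2 V | e ∈ G.edgeSet ∧ edgeSum2 f e ≠ K e}.ncard = n }
      = sInf { n : ℕ | ∃ F : Set (Sym2 V), F ⊆ G.edgeSet ∧ F.ncard = n ∧
        ∀ (u : V) (w : (G.deleteEdges F).Walk u u), w.IsCycle →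
          (w.edges.map K).sum = 0 } := by
  apply le_antisymm
  · obtain ⟨F, -, hn, hc⟩ := Nat.sInf_mem (s := { n : ℕ | ∃ F : Set (Sym2 V),
      F ⊆ G.edgeSet ∧ F.ncard = n ∧ ∀ (u : V) (w : (G.deleteEdges F).Walk u u),
        w.IsCycle → (w.edges.map K).sum = 0 }) ⟨_, G.edgeSet, subset_rfl, rfl, by
          intro u w hw
          cases w with
          | nil => simp
          | cons h q => simp at h⟩
    obtain ⟨f, hf⟩ := SimpleGraph.exists_edgeSum2_eq hc
    rw [← hn]
    refine le_trans (Nat.sInf_le (by exact ⟨f, rfl⟩)) (Set.ncard_le_ncard (fun e he => ?_) F.toFinite)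
    by_contra heF
    exact he.2 (hf e (by rw [SimpleGraph.edgeSet_deleteEdges]; exact ⟨he.1, heF⟩))
  · obtain ⟨f, hf⟩ := Nat.sInf_mem (s := { n : ℕ | ∃ f : V → ZMod 2,
      {e : Sym2 V | e ∈ G.edgeSet ∧ edgeSum2 f e ≠ K e}.ncard = n }) ⟨_, 0, rfl⟩
    refine Nat.sInf_le ⟨{e | e ∈ G.edgeSet ∧ edgeSum2 f e ≠ K e}, fun e he => he.1, hf,
      fun u w _ => ?_⟩
    have hK : w.edges.map K = w.edges.map (edgeSum2 f) := List.map_congr_left fun e he => by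
      have h := w.edges_subset_edgeSet he
      rw [SimpleGraph.edgeSet_deleteEdges] at h
      by_contra hne
      exact h.2 ⟨h.1, Ne.symm hne⟩
    rw [hK, SimpleGraph.Walk.sum_map_edgeSum2, CharTwo.add_self_eq_zero]
end

section
/- Let G be a finite connected simple graph, d ≥ 1, and K : E(G) → Perm(Fin d) an edge-labeling such that each K(e) is an involution. Define the graph KG on vertex set V(G) × Fin d, with (u,s) adjacent to (v,t) if and only if {u,v} ∈ E(G) and K({u,v})(s) = t. Then the number of consistent vertex-assignments of (G,K), i.e. functions f : V(G) → Fin d with K({u,v})(f(u)) = f(v) for every edge {u,v}, equals the number of connected components of KG that are isomorphic (as simple graphs) to G. -/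
/-- The graph `KG` obtained from a graph `G` with edge-labeling
`K : E(G) → Perm (Fin d)`: each vertex `v` of `G` is replaced by `d` vertices
`(v,0), …, (v,d−1)`, and `(u,s)` is joined to `(v,t)` exactly when `{u,v}` is an edge
of `G` and `K({u,v})(s) = t`. -/
def permGraph {V : Type*} (G : SimpleGraph V) (d : ℕ)
    (K : Sym2 V → Equiv.Perm (Fin d)) : SimpleGraph (V × Fin d) :=
  SimpleGraph.fromRel (fun p q => G.Adj p.1 q.1 ∧ K s(p.1, q.1) p.2 = q.2)

theorem permGraph_adj_iff {V : Type*} {G : SimpleGraph V} {d : ℕ} {K : Sym2 V → Equiv.Perm (Fin d)}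
    (hK : ∀ e ∈ G.edgeSet, ∀ s : Fin d, K e (K e s) = s) (p q : V × Fin d) :
    (permGraph G d K).Adj p q ↔ G.Adj p.1 q.1 ∧ K s(p.1, q.1) p.2 = q.2 := by
  rw [permGraph, SimpleGraph.fromRel_adj]
  constructor
  · rintro ⟨-, h | ⟨h, h'⟩⟩
    · exact h
    · refine ⟨h.symm, ?_⟩
      rw [← h', Sym2.eq_swap]
      exact hK _ h _
  · intro h
    exact ⟨fun hpq => h.1.ne (congrArg Prod.fst hpq), Or.inl h⟩

/-- The component of `permGraph G d K` through a point of the graph of a consistent assignment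
is exactly that graph. -/
theorem mem_supp_of_consistent {V : Type*} {G : SimpleGraph V} (hG : G.Connected) {d : ℕ}
    {K : Sym2 V → Equiv.Perm (Fin d)}
    (hK : ∀ e ∈ G.edgeSet, ∀ s : Fin d, K e (K e s) = s) {f : V → Fin d}
    (hf : ∀ u v : V, G.Adj u v → K s(u, v) (f u) = f v) (w : V) (p : V × Fin d) :
    p ∈ ((permGraph G d K).connectedComponentMk (w, f w)).supp ↔ p.2 = f p.1 := by
  rw [SimpleGraph.ConnectedComponent.mem_supp_iff, SimpleGraph.ConnectedComponent.eq]
  constructor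
  · intro h
    obtain ⟨W⟩ := h.symm
    have key : ∀ {a b : V × Fin d}, (permGraph G d K).Walk a b → a.2 = f a.1 → b.2 = f b.1 := by
      intro a b W
      induction W with
      | nil => exact id
      | cons h _ ih =>
        intro ha
        obtain ⟨h₁, h₂⟩ := (permGraph_adj_iff hK _ _).1 h
        exact ih (by rw [← h₂, ha, hf _ _ h₁])
    exact key W rfl
  · intro h
    let φ : G →g permGraph G d K :=
      ⟨fun v => (v, f v), fun {u v} huv => (permGraph_adj_iff hK _ _).2 ⟨huv, hf u v huv⟩⟩
    have hp : p = φ p.1 := Prod.ext rfl h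
    rw [hp]
    exact (hG.preconnected p.1 w).map φ

/-- A component of `permGraph G d K` projects onto the vertices of the connected graph `G`. -/
theorem exists_mem_supp {V : Type*} {G : SimpleGraph V} (hG : G.Connected) {d : ℕ}
    {K : Sym2 V → Equiv.Perm (Fin d)}
    (hK : ∀ e ∈ G.edgeSet, ∀ s : Fin d, K e (K e s) = s)
    (C : (permGraph G d K).ConnectedComponent) (v : V) : ∃ t, (v, t) ∈ C.supp := by
  obtain ⟨⟨u, s⟩, hp⟩ := C.nonempty_supp
  obtain ⟨W⟩ := hG.preconnected u v
  induction W generalizing s with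
  | nil => exact ⟨s, hp⟩
  | @cons u x _ h _ ih =>
    exact ih (K s(u, x) s) (C.mem_supp_of_adj_mem_supp hp ((permGraph_adj_iff hK _ _).2 ⟨h, rfl⟩))

/-- Let `G` be a finite connected simple graph, `d ≥ 1`, and
`K : E(G) → Perm (Fin d)` an edge-labeling by involutions. The number of consistent
vertex-assignments of `(G,K)` — functions `f : V(G) → Fin d` with
`K({u,v})(f(u)) = f(v)` for every edge — equals the number of connected components of
the graph `KG` that are isomorphic (as simple graphs) to `G`. -/
theorem stmt_15 {V : Type*} [Fintype V] (G : SimpleGraph V) (hG : G.Connected)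
    (d : ℕ) (hd : 1 ≤ d) (K : Sym2 V → Equiv.Perm (Fin d))
    (hK : ∀ e ∈ G.edgeSet, ∀ s : Fin d, K e (K e s) = s) :
    Nat.card {f : V → Fin d // ∀ u v : V, G.Adj u v → K s(u, v) (f u) = f v}
      = Nat.card {C : (permGraph G d K).ConnectedComponent //
          Nonempty ((permGraph G d K).induce C.supp ≃g G)} := by
  obtain ⟨w⟩ := hG.nonempty
  refine Nat.card_eq_of_bijective (fun f =>
    ⟨(permGraph G d K).connectedComponentMk (w, f.1 w), ⟨?_⟩⟩) ⟨?_, ?_⟩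
  · have hmem := mem_supp_of_consistent hG hK f.2 w
    exact
      { toFun := fun p => p.1.1
        invFun := fun v => ⟨(v, f.1 v), (hmem _).2 rfl⟩
        left_inv := fun p => Subtype.ext (Prod.ext rfl ((hmem p.1).1 p.2).symm)
        right_inv := fun _ => rfl
        map_rel_iff' := by
          rintro ⟨p, hp⟩ ⟨q, hq⟩
          rw [hmem] at hp hq
          simp only [SimpleGraph.comap_adj, Function.Embedding.subtype_apply,
            permGraph_adj_iff hK, Equiv.coe_fn_mk]
          exact ⟨fun h => ⟨h, by rw [hp, hq, f.2 _ _ h]⟩, And.left⟩ }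
  · intro f g hfg
    have hC := congrArg Subtype.val hfg
    refine Subtype.ext (funext fun v => ?_)
    have h := (mem_supp_of_consistent hG hK f.2 w (v, f.1 v)).2 rfl
    dsimp only at hC
    rw [hC, mem_supp_of_consistent hG hK g.2] at h
    exact h
  · rintro ⟨C, ⟨e⟩⟩
    have hsurj : Function.Surjective (fun p : C.supp => p.1.1) := fun v =>
      let ⟨t, ht⟩ := exists_mem_supp hG hK C v
      ⟨⟨(v, t), ht⟩, rfl⟩
    have hinj : Function.Injective (fun p : C.supp => p.1.1) :=
      (hsurj.injective_of_finite e.toEquiv)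
    choose f hf using exists_mem_supp hG hK C
    refine ⟨⟨f, fun u v huv => ?_⟩, Subtype.ext (hf w)⟩
    have hv := C.mem_supp_of_adj_mem_supp (hf u)
      ((permGraph_adj_iff hK (u, f u) (v, K s(u, v) (f u))).2 ⟨huv, rfl⟩)
    exact congrArg (fun p : C.supp => p.1.2) (@hinj ⟨_, hv⟩ ⟨_, hf v⟩ rfl)
end
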